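/- arXiv:1808.07548 — 7 statements merged into one kernel-verified Lean document; each statement's English description precedes it below -/
import Mathlib

section
/- The map F : ℝ_{>0}^4 → ℝ_{>0}^4 defined by F(κ_1,κ_2,κ_3,κ_4) = ( κ_1κ_3/(κ_2+κ_3), κ_2κ_4/(κ_2+κ_3), κ_1/(κ_2+κ_3), κ_4/(κ_2+κ_3) ) is surjective. -/
/-- **Surjectivity of the realization map for one reversible intermediate.**
The map `F(κ₁,κ₂,κ₃,κ₄) = (κ₁κ₃/(κ₂+κ₃), κ₂κ₄/(κ₂+κ₃), κ₁/(κ₂+κ₃), κ₄/(κ₂+κ₃))`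
from `ℝ_{>0}^4` to `ℝ_{>0}^4` is surjective. -/
theorem stmt_7 :
    ∀ y₁ y₂ y₃ y₄ : ℝ, 0 < y₁ → 0 < y₂ → 0 < y₃ → 0 < y₄ →
      ∃ κ₁ κ₂ κ₃ κ₄ : ℝ, 0 < κ₁ ∧ 0 < κ₂ ∧ 0 < κ₃ ∧ 0 < κ₄ ∧
        κ₁ * κ₃ / (κ₂ + κ₃) = y₁ ∧
        κ₂ * κ₄ / (κ₂ + κ₃) = y₂ ∧
        κ₁ / (κ₂ + κ₃) = y₃ ∧
        κ₄ / (κ₂ + κ₃) = y₄ := by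
  intro y₁ y₂ y₃ y₄ h₁ h₂ h₃ h₄
  have hs : 0 < y₂ / y₄ + y₁ / y₃ := by positivity
  have hs0 := hs.ne'
  refine ⟨y₃ * (y₂ / y₄ + y₁ / y₃), y₂ / y₄, y₁ / y₃, y₄ * (y₂ / y₄ + y₁ / y₃),
    by positivity, by positivity, by positivity, by positivity, ?_, ?_, ?_, ?_⟩
  · rw [div_eq_iff hs0, mul_right_comm, mul_div_cancel₀ _ h₃.ne']
  · rw [div_eq_iff hs0, ← mul_assoc, div_mul_cancel₀ _ h₄.ne']
  · rw [div_eq_iff hs0]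
  · rw [div_eq_iff hs0]
end

section
/- Let n ≥ 1 and 1 ≤ i ≤ n. Let E be the (n+1)×(n+1) real matrix with entries: E_{j,j} = −1 for 1 ≤ j ≤ n, E_{j,j+1} = 1 for 1 ≤ j ≤ n−1, E_{j,n+1} = −1 for 1 ≤ j ≤ n, E_{n+1,i} = −1, E_{n+1,n+1} = −1, and all other entries equal to 0. Then det(E) = (−1)^n (n − i). -/
lemma aux_sum1 (i c : ℕ) (hi1 : 1 ≤ i) (m : ℕ) :
    ∑ k ∈ Finset.range m, (if i ≤ k + 1 then (-1 : ℝ) else 0) *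
      (if k = c then (-1 : ℝ) else if c = k + 1 then 1 else 0) =
    (if i ≤ c + 1 ∧ c < m then 1 else 0) - (if i ≤ c ∧ c ≤ m then 1 else 0) := by
  induction m with
  | zero => 
    have h1 : ¬ (i ≤ c ∧ c ≤ 0) := by omega
    rw [if_neg h1]
    simp
  | succ m ih =>
    rw [Finset.sum_range_succ, ih]
    split_ifs <;> first | omega | norm_num

lemma aux_sum2 (i : ℕ) (hi1 : 1 ≤ i) (m : ℕ) :
    ∑ k ∈ Finset.range m, (if i ≤ k + 1 then (-1 : ℝ) else 0) * (-1) =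
    ((m + 1 - i : ℕ) : ℝ) := by
  induction m with
  | zero => 
    have h1 : 0 + 1 - i = 0 := by omega
    simp [h1]
  | succ m ih =>
    rw [Finset.sum_range_succ, ih]
    split_ifs with h
    · rw [show m + 1 + 1 - i = (m + 1 - i) + 1 by omega]
      push_cast; ring
    · rw [show m + 1 + 1 - i = 0 by omega, show m + 1 - i = 0 by omega]
      simp

/-- **Determinant of the submatrix `Ω(i)_{{n+1,n+3,n+4}}`.**
The `(n+1)×(n+1)` matrix (1-based description) with `E_{j,j} = −1` for `1 ≤ j ≤ n`,
`E_{j,j+1} = 1` for `1 ≤ j ≤ n−1`, `E_{j,n+1} = −1` for `1 ≤ j ≤ n`, `E_{n+1,i} = −1`,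
`E_{n+1,n+1} = −1`, and all other entries `0`, has determinant `(−1)^n (n−i)`.
(Here the matrix is written 0-based.) -/
theorem stmt_9 (n i : ℕ) (hn : 1 ≤ n) (hi1 : 1 ≤ i) (hi2 : i ≤ n) :
    (Matrix.of (fun r c : Fin (n + 1) =>
      if r.val < n ∧ r = c then (-1 : ℝ)
      else if c.val = r.val + 1 ∧ c.val < n then 1
      else if r.val < n ∧ c.val = n then -1
      else if r.val = n ∧ (c.val + 1 = i ∨ c.val = n) then -1
      else 0)).det = (-1) ^ n * ((n : ℝ) - (i : ℝ)) := by
  set M : Matrix (Fin (n+1)) (Fin (n+1)) ℝ := Matrix.of (fun r c : Fin (n + 1) =>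
      if r.val < n ∧ r = c then (-1 : ℝ)
      else if c.val = r.val + 1 ∧ c.val < n then 1
      else if r.val < n ∧ c.val = n then -1
      else if r.val = n ∧ (c.val + 1 = i ∨ c.val = n) then -1
      else 0) with hM
  let co : Fin (n+1) → ℝ := fun k => if k.val = n then 1 else if i ≤ k.val + 1 then -1 else 0
  have hdet := Matrix.det_updateRow_sum M (Fin.last n) co
  have hco : co (Fin.last n) = 1 := by simp [co]
  rw [hco, one_smul] at hdet
  rw [← hdet]
  have hrow : (∑ k, co k • M k) = fun c => if c.val = n then (n : ℝ) - i else 0 := by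
    funext c
    rw [Finset.sum_apply, Fin.sum_univ_castSucc]
    simp only [Pi.smul_apply, smul_eq_mul, hco, one_mul]
    by_cases hc : c.val = n
    · have h1 : ∀ k : Fin n, co k.castSucc * M k.castSucc c =
          (fun k : ℕ => (if i ≤ k + 1 then (-1 : ℝ) else 0) * (-1)) k.val := by
        intro k
        have hk := k.isLt
        simp only [co, hM, Matrix.of_apply, Fin.ext_iff, Fin.val_castSucc]
        split_ifs <;> first | omega | norm_num
      have h2 : M (Fin.last n) c = -1 := by
        simp [hM, hc]
      have h3 := (Finset.sum_congr (s₁ := Finset.univ) rfl (fun k _ => h1 k)).trans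
        ((Fin.sum_univ_eq_sum_range _ n).trans (aux_sum2 i hi1 n))
      rw [h3, h2, if_pos hc, Nat.cast_sub (by omega)]
      push_cast; ring
    · have hc' := c.isLt
      have h1 : ∀ k : Fin n, co k.castSucc * M k.castSucc c =
          (fun k : ℕ => (if i ≤ k + 1 then (-1 : ℝ) else 0) *
            (if k = c.val then (-1 : ℝ) else if c.val = k + 1 then 1 else 0)) k.val := by
        intro k
        have hk := k.isLt
        simp only [co, hM, Matrix.of_apply, Fin.ext_iff, Fin.val_castSucc]
        split_ifs <;> first | omega | norm_num
      have h2 : M (Fin.last n) c = if c.val + 1 = i then -1 else 0 := by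
        simp only [hM, Matrix.of_apply, Fin.ext_iff, Fin.val_last]
        split_ifs <;> first | omega | (simp_all; done) | (exfalso; simp_all; done)
      have h3 := (Finset.sum_congr (s₁ := Finset.univ) rfl (fun k _ => h1 k)).trans
        ((Fin.sum_univ_eq_sum_range _ n).trans (aux_sum1 i c.val hi1 n))
      rw [h3, h2, if_neg hc]
      split_ifs <;> first | omega | norm_num
  rw [hrow, Matrix.det_of_isUpperTriangular, Fin.prod_univ_castSucc]
  · have h1 : ∀ k : Fin n, (M.updateRow (Fin.last n)
        (fun c => if c.val = n then (n : ℝ) - i else 0)) k.castSucc k.castSucc = -1 := by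
      intro k
      rw [Matrix.updateRow_ne (Fin.castSucc_lt_last k).ne]
      simp [hM]
    rw [Finset.prod_congr rfl (fun k _ => h1 k)]
    simp
  · intro r c hrc
    have hrc' : c.val < r.val := hrc
    have hr := r.isLt
    by_cases h : r = Fin.last n
    · subst h
      rw [Matrix.updateRow_self]
      simp only [Fin.val_last] at hrc'
      simp [hrc'.ne]
    · rw [Matrix.updateRow_ne h]
      have h' : r.val ≠ n := fun e => h (Fin.ext e)
      simp only [hM, Matrix.of_apply, Fin.ext_iff]
      split_ifs <;> first | omega | norm_num
end

section
/- Let n ≥ 2 be an integer, let a, b, c, d, e, f, g be strictly positive real numbers, and let z_1, z_2 be strictly positive real numbers satisfying z_2 ≤ n·z_1. Then the determinant of the 7×7 real matrix [[−a, 0, −c, d, 0, 0, 0], [−a, −b, 0, 0, e, 0, 0], [−a, (n−1)b, −n·c, 0, 0, f, 0], [−a, n·b, −(n+1)·c, 0, 0, 0, g], [1 + z_1·a, −z_2·b, z_2·c, 1, 1, 1, 1], [0, 1, 0, 1, 1, 0, 0], [0, 0, 1, 0, 0, 1, 1]] is strictly positive. -/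
set_option maxHeartbeats 4000000 in
/-- **Positivity of the 7×7 block determinant** appearing in the proof that
`{c_n, c_{n+1}, c_{2n+1}, c_{2n+2}}` is not in the multistationarity structure of the
core `n`-site phosphorylation network. -/
theorem stmt_10 (n : ℕ) (hn : 2 ≤ n) (a b c d e f g z₁ z₂ : ℝ)
    (ha : 0 < a) (hb : 0 < b) (hc : 0 < c) (hd : 0 < d) (he : 0 < e) (hf : 0 < f)
    (hg : 0 < g) (hz₁ : 0 < z₁) (hz₂ : 0 < z₂) (hz : z₂ ≤ (n : ℝ) * z₁) :
    0 < Matrix.det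
      !![-a, 0, -c, d, 0, 0, 0;
         -a, -b, 0, 0, e, 0, 0;
         -a, ((n : ℝ) - 1) * b, -(n : ℝ) * c, 0, 0, f, 0;
         -a, (n : ℝ) * b, -((n : ℝ) + 1) * c, 0, 0, 0, g;
         1 + z₁ * a, -z₂ * b, z₂ * c, 1, 1, 1, 1;
         0, 1, 0, 1, 1, 0, 0;
         0, 0, 1, 0, 0, 1, 1] := by
  obtain ⟨m, rfl⟩ : ∃ m, n = m + 1 := ⟨n - 1, by omega⟩
  have hm : (0 : ℝ) ≤ (m : ℝ) := Nat.cast_nonneg m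
  have ht : 0 ≤ ((m + 1 : ℕ) : ℝ) * z₁ - z₂ := sub_nonneg.mpr hz
  push_cast at ht ⊢
  generalize (m : ℝ) = k at *
  obtain ⟨t, htt⟩ : ∃ t, t = (k + 1) * z₁ - z₂ := ⟨_, rfl⟩
  rw [← htt] at ht
  have key : 0 < (d*e+b*d)*(f*g+(k+1)*c*g+(k+2)*c*f) + c*e*(k*b*g+(k+1)*b*f)
      + z₁*a*((d*e+b*d)*(f*g+c*f) + c*e*(k*b*g+(k+1)*b*f))
      + a*(d*e+b*d)*c*(f+g)*t
      + z₂*a*(b*(d+e)*f*g + b*c*d*(f+g))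
      + a*((d+e)*f*g + (d+e)*(k*c*g+(k+1)*c*f) + c*d*(f+g))
      + a*((d+e)*(k*b*g+(k+1)*b*f) + (d*e+b*d)*(f+g)) := by
    positivity
  refine lt_of_lt_of_eq key ?_
  rw [htt]
  simp [Matrix.det_succ_row_zero, Fin.sum_univ_succ, Fin.succAbove]
  ring
end

section
/- Let n ≥ 1 and 1 ≤ i ≤ n. Work in the polynomial ring ℝ[X_1,…,X_{n+4}] and let A(n,i) be the (n+4)×(n+4) matrix over this ring defined as follows: for 1 ≤ j ≤ n, row j has entries −X_j in column j, X_{j+1} in column j+1, −X_{n+2} in column n+2, X_{n+3} in column n+3, and 0 elsewhere; row n+1 has entries −X_i in column i, −X_{n+2} in column n+2, X_{n+4} in column n+4, and 0 elsewhere; row n+2 has entry 1 in columns 1,…,n+1 and in column n+4, and 0 elsewhere; row n+3 has entry 1 in columns n+2 and n+4, and 0 elsewhere; row n+4 has entry 1 in column n+3 and 0 elsewhere. Then in det(A(n,i)): the coefficient of the monomial ∏_{j∈{1,…,n+4}\{1,n+2,n+3}} X_j equals (−1)^{n+1}, and the coefficient of the monomial ∏_{j∈{1,…,n+4}\{n+1,n+3,n+4}}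 X_j equals (−1)^n (n − i). -/
open MvPolynomial

/-- The matrix `Γ̃_{{c_i}}` of the determinant criterion for the canonical extension of the
core `n`-site phosphorylation network with a single intermediate with input `c_i`.
Indexing is 0-based: the variable `X_j` (1-based) of the statement is `X ⟨j-1⟩`. -/
noncomputable def phosMatrix (n i : ℕ) :
    Matrix (Fin (n + 4)) (Fin (n + 4)) (MvPolynomial (Fin (n + 4)) ℝ) :=
  Matrix.of fun r c =>
    if r.val < n then
      (if c.val = r.val then -X c
       else if c.val = r.val + 1 then X c
       else if c.val = n + 1 then -X c
       else if c.val = n + 2 then X c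
       else 0)
    else if r.val = n then
      (if c.val + 1 = i then -X c
       else if c.val = n + 1 then -X c
       else if c.val = n + 3 then X c
       else 0)
    else if r.val = n + 1 then
      (if c.val ≤ n ∨ c.val = n + 3 then 1 else 0)
    else if r.val = n + 2 then
      (if c.val = n + 1 ∨ c.val = n + 3 then 1 else 0)
    else
      (if c.val = n + 2 then 1 else 0)

theorem coeff_det_gen {m : Type*} [Fintype m] [DecidableEq m] (B : Matrix m m ℝ)
    (P : m → Prop) [DecidablePred P] (T : Finset m)
    (M : Matrix m m (MvPolynomial m ℝ))
    (hM : ∀ r c, M r c = C (B r c) * if P r then X c else 1) :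
    MvPolynomial.coeff (∑ j ∈ T, Finsupp.single j 1) M.det =
      (Matrix.of fun r c => if (P r ↔ c ∈ T) then B r c else 0 : Matrix m m ℝ).det := by
  rw [Matrix.det_apply', Matrix.det_apply', coeff_sum]
  refine Finset.sum_congr rfl fun σ _ => ?_
  have h1 : (∏ c, M (σ c) c) = monomial (∑ j ∈ Finset.univ.filter (fun c => P (σ c)), Finsupp.single j 1) (∏ c, B (σ c) c) := by
    simp only [hM, Finset.prod_mul_distrib]
    rw [← map_prod, Finset.prod_ite, Finset.prod_const_one, mul_one]
    rw [← mul_one (∏ c, B (σ c) c), ← C_mul_monomial, mul_one, monomial_sum_one]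
    rfl
  have h2 : ((Equiv.Perm.sign σ : ℤ) : MvPolynomial m ℝ) = C ((Equiv.Perm.sign σ : ℤ) : ℝ) := by simp
  rw [h1, h2, coeff_C_mul, coeff_monomial]
  congr 1
  have hs : ∀ (U : Finset m) (a : m), (∑ j ∈ U, Finsupp.single j 1 : m →₀ ℕ) a = if a ∈ U then 1 else 0 := by
    intro U a
    simp [Finsupp.finsetSum_apply, Finsupp.single_apply]
  simp only [Matrix.of_apply]
  split_ifs with h
  · refine Finset.prod_congr rfl fun c _ => ?_
    have := DFunLike.congr_fun h c
    rw [hs, hs] at this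
    rw [if_pos]
    by_cases h3 : P (σ c) <;> by_cases h4 : c ∈ T <;> simp_all
  · symm
    by_contra h0
    apply h
    have : ∀ c, (P (σ c) ↔ c ∈ T) := by
      intro c
      by_contra hc
      exact h0 (Finset.prod_eq_zero (Finset.mem_univ c) (if_neg hc))
    congr 1
    ext c
    simp [this]

noncomputable def phosB (n i : ℕ) : Matrix (Fin (n + 4)) (Fin (n + 4)) ℝ :=
  Matrix.of fun r c =>
    if r.val < n then
      (if c.val = r.val then -1
       else if c.val = r.val + 1 then 1
       else if c.val = n + 1 then -1
       else if c.val = n + 2 then 1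
       else 0)
    else if r.val = n then
      (if c.val + 1 = i then -1
       else if c.val = n + 1 then -1
       else if c.val = n + 3 then 1
       else 0)
    else if r.val = n + 1 then
      (if c.val ≤ n ∨ c.val = n + 3 then 1 else 0)
    else if r.val = n + 2 then
      (if c.val = n + 1 ∨ c.val = n + 3 then 1 else 0)
    else
      (if c.val = n + 2 then 1 else 0)

theorem phos_eq (n i : ℕ) (r c : Fin (n+4)) :
    phosMatrix n i r c = C (phosB n i r c) * if r.val ≤ n then X c else 1 := by
  simp only [phosMatrix, phosB, Matrix.of_apply]
  by_cases h1 : r.val < n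
  · simp only [h1, h1.le, if_true]
    split_ifs <;> simp
  · by_cases h2 : r.val = n
    · simp only [h2, lt_irrefl, le_refl, if_true, if_false]
      split_ifs <;> simp
    · have h3 : ¬ r.val ≤ n := by omega
      simp only [h1, h2, h3, if_false]
      split_ifs <;> simp

theorem det_two (n i : ℕ) (hi1 : 1 ≤ i) (hi2 : i ≤ n) (T : Finset (Fin (n+4)))
    (hT : ∀ c : Fin (n+4), c ∈ T ↔ (c.val < n ∨ c.val = n+1)) :
    (Matrix.of fun r c => if (r.val ≤ n ↔ c ∈ T) then phosB n i r c else 0 :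
      Matrix (Fin (n+4)) (Fin (n+4)) ℝ).det = (-1) ^ n * ((n : ℝ) - (i : ℝ)) := by
  rw [← Matrix.det_submatrix_equiv_self (finSumFinEquiv (m := n) (n := 4))]
  set A : Matrix (Fin n) (Fin n) ℝ := Matrix.of fun r c =>
    if c.val = r.val then -1 else if c.val = r.val + 1 then 1 else 0 with hA
  set B : Matrix (Fin n) (Fin 4) ℝ := Matrix.of fun r c => if c = 1 then -1 else 0 with hB
  set D : Matrix (Fin 4) (Fin n) ℝ := Matrix.of fun r c =>
    if r = 0 then (if c.val + 1 = i then -1 else 0) else 0 with hD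
  set E : Matrix (Fin 4) (Fin 4) ℝ := !![0,-1,0,0; 1,0,0,1; 0,0,0,1; 0,0,1,0] with hE
  set V : Matrix (Fin n) (Fin 4) ℝ := Matrix.of fun r c => if c = 1 then -((n:ℝ) - r.val) else 0 with hV
  have hM : (Matrix.of fun r c => if (r.val ≤ n ↔ c ∈ T) then phosB n i r c else 0 :
      Matrix (Fin (n+4)) (Fin (n+4)) ℝ).submatrix (finSumFinEquiv (m := n) (n := 4)) (finSumFinEquiv (m := n) (n := 4)) = Matrix.fromBlocks A B D E := by
    ext r c
    rcases r with r | r <;> rcases c with c | c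
    · have := c.2
      have := r.2
      simp only [Matrix.submatrix_apply, Matrix.of_apply, hT, phosB, finSumFinEquiv_apply_left, Matrix.fromBlocks_apply₁₁, hA, Fin.val_castAdd]
      grind
    · have := r.2
      simp only [Matrix.submatrix_apply, Matrix.of_apply, hT, phosB, finSumFinEquiv_apply_left, finSumFinEquiv_apply_right, Matrix.fromBlocks_apply₁₂, hB, Fin.val_castAdd, Fin.val_natAdd]
      fin_cases c <;> simp <;> grind
    · have := c.2
      simp only [Matrix.submatrix_apply, Matrix.of_apply, hT, phosB, finSumFinEquiv_apply_left, finSumFinEquiv_apply_right, Matrix.fromBlocks_apply₂₁, hD, Fin.val_castAdd, Fin.val_natAdd]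
      fin_cases r <;> simp <;> grind
    · simp only [Matrix.submatrix_apply, Matrix.of_apply, hT, phosB, finSumFinEquiv_apply_right, Matrix.fromBlocks_apply₂₂, hE, Fin.val_natAdd]
      fin_cases r <;> fin_cases c <;> simp <;> grind
  rw [hM]
  have hAV : A * V + B = 0 := by
    ext r c
    simp only [Matrix.add_apply, Matrix.mul_apply, Matrix.zero_apply, hA, hV, hB, Matrix.of_apply]
    by_cases hc : c = 1
    · simp only [hc, if_true]
      have : ∀ x : Fin n, ((if x.val = r.val then (-1:ℝ) else if x.val = r.val + 1 then 1 else 0) * -((n:ℝ) - x.val))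
          = (if x = r then ((n:ℝ) - r.val) else 0) + (if x.val = r.val + 1 then -((n:ℝ) - (r.val + 1)) else 0) := by
        intro x
        simp only [Fin.ext_iff]
        by_cases h1 : x.val = r.val
        · simp [h1]
        · by_cases h2 : x.val = r.val + 1 <;> simp [h1, h2]
      rw [Finset.sum_congr rfl fun x _ => this x, Finset.sum_add_distrib, Finset.sum_ite_eq' ]
      by_cases hr : r.val + 1 < n
      · rw [Finset.sum_eq_single (⟨r.val+1, hr⟩ : Fin n)]
        · simp
        · intro b _ hb
          rw [if_neg]
          intro h; exact hb (Fin.ext h)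
        · simp
      · rw [Finset.sum_eq_zero]
        · have : n = r.val + 1 := by omega
          have h' : (n:ℝ) = r.val + 1 := by exact_mod_cast this
          simp [h']
        · intro b _
          rw [if_neg]; omega
    · simp [hc]
  have hmul : Matrix.fromBlocks A B D E * Matrix.fromBlocks 1 V 0 1 = Matrix.fromBlocks A 0 D (D * V + E) := by
    rw [Matrix.fromBlocks_multiply]; simp [hAV]
  have hdet := congrArg Matrix.det hmul
  rw [Matrix.det_mul, Matrix.det_fromBlocks_zero₂₁, Matrix.det_fromBlocks_zero₁₂] at hdet
  simp only [Matrix.det_one, mul_one] at hdet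
  rw [hdet]
  have hdA : A.det = (-1)^n := by
    rw [Matrix.det_of_upperTriangular]
    · simp [hA]
    · intro r c h
      have : c.val < r.val := h
      simp only [hA, Matrix.of_apply]
      rw [if_neg, if_neg] <;> omega
  have hDV : D * V + E = !![0,(n:ℝ)-i,0,0; 1,0,0,1; 0,0,0,1; 0,0,1,0] := by
    have key : (D * V) = Matrix.of fun r c => if r = 0 ∧ c = 1 then (n:ℝ) - i + 1 else 0 := by
      ext r c
      simp only [Matrix.mul_apply, hD, hV, Matrix.of_apply]
      rw [Finset.sum_eq_single (⟨i-1, by omega⟩ : Fin n)]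
      · have : i - 1 + 1 = i := by omega
        by_cases h1 : r = 0 <;> by_cases h2 : c = 1 <;> simp [h1, h2, this, Nat.cast_sub hi1]
        ring
      · intro b _ hb
        have : ¬ (b.val + 1 = i) := by
          intro h; apply hb; ext; simp; omega
        simp [this]
      · simp
    rw [key, hE]
    ext r c
    fin_cases r <;> fin_cases c <;> simp
  rw [hdA, hDV]
  congr 1
  simp [Matrix.det_succ_row_zero, Fin.sum_univ_succ, Fin.succAbove]

theorem det_one' (n i : ℕ) (hi1 : 1 ≤ i) (hi2 : i ≤ n) (T : Finset (Fin (n+4)))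
    (hT : ∀ c : Fin (n+4), c ∈ T ↔ (c.val ≠ 0 ∧ c.val ≠ n + 1 ∧ c.val ≠ n+2)) :
    (Matrix.of fun r c => if (r.val ≤ n ↔ c ∈ T) then phosB n i r c else 0 :
      Matrix (Fin (n+4)) (Fin (n+4)) ℝ).det = (-1) ^ (n+1) := by
  have hz : ∀ (r : Fin (n+4)), (r.val = n+1) → ∀ c : Fin (n+4), c ≠ 0 → (if (r.val ≤ n ↔ c ∈ T) then phosB n i r c else 0) = 0 := by
    intro r hr c hc
    have : c.val ≠ 0 := fun h => hc (Fin.ext h)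
    simp only [hT, phosB, Matrix.of_apply]
    grind
  rw [Matrix.det_succ_row _ (⟨n+1, by omega⟩ : Fin (n+4)), Finset.sum_eq_single 0]
  rotate_left
  · intro c _ hc
    rw [Matrix.of_apply, hz _ rfl c hc]; simp
  · simp
  have h0 : (if ((⟨n+1, by omega⟩ : Fin (n+4)).val ≤ n ↔ (0 : Fin (n+4)) ∈ T) then phosB n i ⟨n+1, by omega⟩ 0 else 0) = 1 := by
    simp [hT, phosB]
  rw [Matrix.of_apply, h0]
  rw [← Matrix.det_submatrix_equiv_self (finSumFinEquiv (m := n) (n := 3))]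
  set A : Matrix (Fin n) (Fin n) ℝ := Matrix.of fun r c =>
    if c.val = r.val then 1 else if c.val + 1 = r.val then -1 else 0 with hA
  set D : Matrix (Fin 3) (Fin n) ℝ := Matrix.of fun r c =>
    if r = 0 then (if c.val + 2 = i then -1 else 0) else 0 with hD
  set E : Matrix (Fin 3) (Fin 3) ℝ := !![0,0,1; 1,0,0; 0,1,0] with hE
  have hsl : ∀ r : Fin n, ((⟨n+1, by omega⟩ : Fin (n+4)).succAbove (Fin.castAdd 3 r)).val = r.val := by
    intro r
    have := r.2
    rw [Fin.succAbove_of_castSucc_lt]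
    · simp
    · simp [Fin.lt_def] <;> omega
  have hsr : ∀ r : Fin 3, ((⟨n+1, by omega⟩ : Fin (n+4)).succAbove (Fin.natAdd n r)).val = n + (if r.val = 0 then 0 else r.val + 1) := by
    intro r
    by_cases h : r.val = 0
    · rw [Fin.succAbove_of_castSucc_lt]
      · simp [h]
      · simp [Fin.lt_def]; omega
    · rw [Fin.succAbove_of_le_castSucc]
      · simp [h]; omega
      · simp [Fin.le_def]; omega
  have hc : ∀ c : Fin (n+3), ((0 : Fin (n+4)).succAbove c).val = c.val + 1 := by
    intro c; simp
  have hM : (((Matrix.of fun r c => if (r.val ≤ n ↔ c ∈ T) then phosB n i r c else 0 :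
      Matrix (Fin (n+4)) (Fin (n+4)) ℝ).submatrix (Fin.succAbove (⟨n+1, by omega⟩ : Fin (n+4))) (Fin.succAbove 0)).submatrix (finSumFinEquiv (m := n) (n := 3)) (finSumFinEquiv (m := n) (n := 3))) = Matrix.fromBlocks A 0 D E := by
    ext r c
    rcases r with r | r <;> rcases c with c | c
    · have := c.2
      have := r.2
      simp only [Matrix.submatrix_apply, Matrix.of_apply, hT, phosB, finSumFinEquiv_apply_left, Matrix.fromBlocks_apply₁₁, hA, hsl, hc, Fin.val_castAdd]
      grind
    · have := r.2
      have := c.2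
      simp only [Matrix.submatrix_apply, Matrix.of_apply, hT, phosB, finSumFinEquiv_apply_left, finSumFinEquiv_apply_right, Matrix.fromBlocks_apply₁₂, Matrix.zero_apply, hsl, hc, Fin.val_natAdd]
      grind
    · have := c.2
      simp only [Matrix.submatrix_apply, Matrix.of_apply, hT, phosB, finSumFinEquiv_apply_left, finSumFinEquiv_apply_right, Matrix.fromBlocks_apply₂₁, hD, Fin.val_castAdd, hsr, hc]
      fin_cases r <;> simp <;> grind
    · simp only [Matrix.submatrix_apply, Matrix.of_apply, hT, phosB, finSumFinEquiv_apply_right, Matrix.fromBlocks_apply₂₂, hE, Fin.val_natAdd, hsr, hc]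
      fin_cases r <;> fin_cases c <;> simp <;> grind
  rw [hM, Matrix.det_fromBlocks_zero₁₂]
  have hdA : A.det = 1 := by
    rw [Matrix.det_of_lowerTriangular]
    · simp [hA]
    · intro r c h
      have : r.val < c.val := h
      simp only [hA, Matrix.of_apply]
      rw [if_neg, if_neg] <;> omega
  have hdE : E.det = 1 := by
    rw [hE, Matrix.det_fin_three]; simp
  rw [hdA, hdE]
  simp

theorem stmt_11 (n i : ℕ) (hn : 1 ≤ n) (hi1 : 1 ≤ i) (hi2 : i ≤ n) :
    MvPolynomial.coeff
        (∑ j ∈ (Finset.univ \ {(⟨0, by omega⟩ : Fin (n + 4)), ⟨n + 1, by omega⟩,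
          ⟨n + 2, by omega⟩}), Finsupp.single j 1)
        (phosMatrix n i).det = (-1) ^ (n + 1) ∧
    MvPolynomial.coeff
        (∑ j ∈ (Finset.univ \ {(⟨n, by omega⟩ : Fin (n + 4)), ⟨n + 2, by omega⟩,
          ⟨n + 3, by omega⟩}), Finsupp.single j 1)
        (phosMatrix n i).det = (-1) ^ n * ((n : ℝ) - (i : ℝ)) := by
  constructor
  · rw [coeff_det_gen (phosB n i) (fun r => r.val ≤ n) _ _ (phos_eq n i)]
    apply det_one' n i hi1 hi2
    intro c
    simp only [Finset.mem_sdiff, Finset.mem_univ, true_and, Finset.mem_insert, Finset.mem_singleton, Fin.ext_iff, not_or, ne_eq]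
  · rw [coeff_det_gen (phosB n i) (fun r => r.val ≤ n) _ _ (phos_eq n i)]
    apply det_two n i hi1 hi2
    intro c
    have := c.2
    simp only [Finset.mem_sdiff, Finset.mem_univ, true_and, Finset.mem_insert, Finset.mem_singleton, Fin.ext_iff, not_or, ne_eq]
    omega
end

section
/- Let n ≥ 2 and 1 ≤ i ≤ n−1. Let A(n,i) be the (n+4)×(n+4) matrix over ℝ[X_1,…,X_{n+4}] defined as follows: for 1 ≤ j ≤ n, row j has entries −X_j in column j, X_{j+1} in column j+1, −X_{n+2} in column n+2, X_{n+3} in column n+3, and 0 elsewhere; row n+1 has entries −X_i in column i, −X_{n+2} in column n+2, X_{n+4} in column n+4, and 0 elsewhere; row n+2 has entry 1 in columns 1,…,n+1 and in column n+4, and 0 elsewhere; row n+3 has entry 1 in columns n+2 and n+4, and 0 elsewhere; row n+4 has entry 1 in column n+3 and 0 elsewhere. Then the polynomial det(A(n,i)) has at least one positive coefficient and at least one negative coefficient. -/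
open MvPolynomial

namespace PhosAux

/-- real entries -/
noncomputable def ent (n i : ℕ) (x : ℕ → ℝ) (r c : ℕ) : ℝ :=
    if r < n then
      (if c = r then -x c
       else if c = r + 1 then x c
       else if c = n + 1 then -x c
       else if c = n + 2 then x c
       else 0)
    else if r = n then
      (if c + 1 = i then -x c
       else if c = n + 1 then -x c
       else if c = n + 3 then x c
       else 0)
    else if r = n + 1 then
      (if c ≤ n ∨ c = n + 3 then 1 else 0)
    else if r = n + 2 then
      (if c = n + 1 ∨ c = n + 3 then 1 else 0)
    else
      (if c = n + 2 then 1 else 0)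

noncomputable def row (n i : ℕ) (x w : ℕ → ℝ) (r : ℕ) : ℝ :=
  ∑ c ∈ Finset.range (n + 4), ent n i x r c * w c

lemma det_eval (n i : ℕ) (x : ℕ → ℝ) :
    eval (fun c : Fin (n + 4) => x c) (phosMatrix n i).det
      = (Matrix.of fun r c : Fin (n + 4) => ent n i x r c).det := by
  rw [RingHom.map_det]
  congr 1
  ext r c
  simp only [RingHom.mapMatrix_apply, Matrix.map_apply, phosMatrix, Matrix.of_apply, ent]
  split_ifs <;> simp

lemma row_lt (n i : ℕ) (x w : ℕ → ℝ) (r : ℕ) (hr : r < n) :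
    row n i x w r = -(x r * w r) + x (r + 1) * w (r + 1) - x (n + 1) * w (n + 1)
      + x (n + 2) * w (n + 2) := by
  have : ∀ c ∈ Finset.range (n + 4), ent n i x r c * w c =
      (if c = r then -(x c * w c) else 0) + (if c = r + 1 then x c * w c else 0)
      + (if c = n + 1 then -(x c * w c) else 0) + (if c = n + 2 then x c * w c else 0) := by
    intro c _
    unfold ent
    split_ifs <;> first | omega | ring
  rw [row, Finset.sum_congr rfl this]
  simp only [Finset.sum_add_distrib, Finset.sum_ite_eq', Finset.mem_range]
  rw [if_pos (by omega), if_pos (by omega), if_pos (by omega), if_pos (by omega)]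
  ring

lemma row_n (n k : ℕ) (x w : ℕ → ℝ) (hk : k < n) :
    row n (k + 1) x w n = -(x k * w k) - x (n + 1) * w (n + 1)
      + x (n + 3) * w (n + 3) := by
  have : ∀ c ∈ Finset.range (n + 4), ent n (k + 1) x n c * w c =
      (if c = k then -(x c * w c) else 0)
      + (if c = n + 1 then -(x c * w c) else 0) + (if c = n + 3 then x c * w c else 0) := by
    intro c _
    unfold ent
    split_ifs <;> first | omega | ring
  rw [row, Finset.sum_congr rfl this]
  simp only [Finset.sum_add_distrib, Finset.sum_ite_eq', Finset.mem_range]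
  rw [if_pos (by omega), if_pos (by omega), if_pos (by omega)]
  ring

lemma row_n1 (n i : ℕ) (x w : ℕ → ℝ) :
    row n i x w (n + 1) = ∑ c ∈ Finset.range (n + 1), w c + w (n + 3) := by
  have h : ∀ c ∈ Finset.range (n + 1), ent n i x (n + 1) c * w c = w c := by
    intro c hc
    have := Finset.mem_range.1 hc
    unfold ent
    split_ifs <;> first | omega | ring
  rw [row, Finset.sum_range_succ, Finset.sum_range_succ, Finset.sum_range_succ,
    Finset.sum_congr rfl h]
  simp [ent]

lemma row_n2 (n i : ℕ) (x w : ℕ → ℝ) :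
    row n i x w (n + 2) = w (n + 1) + w (n + 3) := by
  have h : ∀ c ∈ Finset.range (n + 1), ent n i x (n + 2) c * w c = 0 := by
    intro c hc
    have := Finset.mem_range.1 hc
    unfold ent
    split_ifs <;> first | omega | ring
  rw [row, Finset.sum_range_succ, Finset.sum_range_succ, Finset.sum_range_succ,
    Finset.sum_eq_zero h]
  simp [ent]

lemma row_n3 (n i : ℕ) (x w : ℕ → ℝ) :
    row n i x w (n + 3) = w (n + 2) := by
  have h : ∀ c ∈ Finset.range (n + 1), ent n i x (n + 3) c * w c = 0 := by
    intro c hc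
    have := Finset.mem_range.1 hc
    unfold ent
    split_ifs <;> first | omega | ring
  rw [row, Finset.sum_range_succ, Finset.sum_range_succ, Finset.sum_range_succ,
    Finset.sum_eq_zero h]
  simp [ent]

lemma mulVec_row (n i : ℕ) (x w : ℕ → ℝ) (r : Fin (n + 4)) :
    ((Matrix.of fun r c : Fin (n + 4) => ent n i x r c).mulVec (fun c => w c)) r
      = row n i x w r := by
  simp only [Matrix.mulVec, dotProduct, Matrix.of_apply, row]
  exact Fin.sum_univ_eq_sum_range (fun c => ent n i x r c * w c) (n + 4)

lemma det_ne (n k : ℕ) (hk : k < n) : (phosMatrix n (k + 1)).det ≠ 0 := by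
  intro h0
  set x : ℕ → ℝ := fun c => if c ≤ n then 1 else 0 with hx
  have h := det_eval n (k + 1) x
  rw [h0, map_zero] at h
  obtain ⟨v, hv, hM⟩ := Matrix.exists_mulVec_eq_zero_iff.2 h.symm
  apply hv
  set w : ℕ → ℝ := fun c => if h : c < n + 4 then v ⟨c, h⟩ else 0 with hw
  have hvw : v = fun c : Fin (n + 4) => w c := by
    ext c; simp [hw]
  rw [hvw] at hM
  have hr : ∀ r, r < n + 4 → row n (k + 1) x w r = 0 := by
    intro r hr
    rw [← mulVec_row n (k + 1) x w ⟨r, hr⟩, hM]; rfl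
  have e1 : ∀ r, r < n → w (r + 1) = w r := by
    intro r hrn
    have := hr r (by omega)
    rw [row_lt _ _ _ _ _ hrn] at this
    simp only [hx] at this
    rw [if_pos (by omega), if_pos (by omega), if_neg (by omega), if_neg (by omega)] at this
    linarith
  have e2 : ∀ r, r ≤ n → w r = w 0 := by
    intro r
    induction r with
    | zero => simp
    | succ r ih => intro h; rw [e1 r (by omega), ih (by omega)]
  have e3 : w k = 0 := by
    have := hr n (by omega)
    rw [row_n _ _ _ _ hk] at this
    simp only [hx] at this
    rw [if_pos (by omega), if_neg (by omega), if_neg (by omega)] at this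
    linarith
  have e4 : ∀ r, r ≤ n → w r = 0 := by
    intro r h
    rw [e2 r h, ← e2 k hk.le, e3]
  have e5 : w (n + 3) = 0 := by
    have := hr (n + 1) (by omega)
    rw [row_n1, Finset.sum_eq_zero (fun c hc => e4 c (by have := Finset.mem_range.1 hc; omega))]
      at this
    linarith
  have e6 : w (n + 1) = 0 := by
    have := hr (n + 2) (by omega)
    rw [row_n2] at this
    linarith
  have e7 : w (n + 2) = 0 := by
    have := hr (n + 3) (by omega)
    rwa [row_n3] at this
  rw [hvw]
  ext ⟨c, hc⟩
  have : c ≤ n ∨ c = n + 1 ∨ c = n + 2 ∨ c = n + 3 := by omega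
  rcases this with h | rfl | rfl | rfl
  · exact e4 c h
  · exact e6
  · exact e7
  · exact e5

lemma det_zero (n k : ℕ) (hk : k + 2 ≤ n) :
    ∃ x : ℕ → ℝ, (∀ c, 0 < x c) ∧
      eval (fun c : Fin (n + 4) => x c) (phosMatrix n (k + 1)).det = 0 := by
  obtain ⟨m, hn⟩ := Nat.exists_eq_add_of_le hk
  -- n = k + 2 + m ; indices k+2 .. n number m+1
  set q : ℝ := (k + 3) / (m + 1) with hq
  have hq0 : 0 < q := by positivity
  set u : ℕ → ℝ := fun c => (c : ℝ) - k - 3 / 2 with hu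
  set w : ℕ → ℝ := fun c => if c ≤ k + 1 then -1 else if c ≤ n then q else
    if c = n + 1 then 1 else if c = n + 2 then 0 else -1 with hw
  set x : ℕ → ℝ := fun c => if c ≤ n then u c / w c else
    if c = n + 3 then 1 / 2 else 1 with hx
  have hwn : ∀ c, c ≤ n → w c ≠ 0 := by
    intro c hc
    simp only [hw]
    split_ifs
    · norm_num
    · exact hq0.ne'
  have hxw : ∀ c, c ≤ n → x c * w c = u c := by
    intro c hc
    simp only [hx, if_pos hc]
    exact div_mul_cancel₀ _ (hwn c hc)
  have w1 : w (n + 1) = 1 := by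
    simp only [hw]
    rw [if_neg (by omega), if_neg (by omega), if_pos trivial]
  have w2 : w (n + 2) = 0 := by
    simp only [hw]
    rw [if_neg (by omega), if_neg (by omega), if_neg (by omega), if_pos trivial]
  have w3 : w (n + 3) = -1 := by
    simp only [hw]
    rw [if_neg (by omega), if_neg (by omega), if_neg (by omega), if_neg (by omega)]
  have x1 : x (n + 1) = 1 := by
    simp only [hx]
    rw [if_neg (by omega), if_neg (by omega)]
  have x3 : x (n + 3) = 1 / 2 := by
    simp only [hx]
    rw [if_neg (by omega), if_pos trivial]
  refine ⟨x, ?_, ?_⟩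
  · intro c
    by_cases hc : c ≤ n
    · simp only [hx, if_pos hc, hw, hu]
      split_ifs with h
      · have : (c : ℝ) ≤ k + 1 := by exact_mod_cast h
        apply div_pos_of_neg_of_neg <;> linarith
      · have : (k : ℝ) + 2 ≤ c := by exact_mod_cast (by omega : k + 2 ≤ c)
        apply div_pos _ hq0; linarith
    · simp only [hx, if_neg hc]
      split_ifs <;> norm_num
  · rw [det_eval]
    apply Matrix.exists_mulVec_eq_zero_iff.1
    refine ⟨fun c => w c, ?_, ?_⟩
    · intro h
      have := congrFun h ⟨n + 1, by omega⟩
      simp only [w1] at this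
      norm_num at this
    · ext ⟨r, hr⟩
      rw [mulVec_row]
      have : r < n ∨ r = n ∨ r = n + 1 ∨ r = n + 2 ∨ r = n + 3 := by omega
      simp only [Pi.zero_apply]
      rcases this with h | rfl | rfl | rfl | rfl
      · rw [row_lt _ _ _ _ _ h, hxw r (by omega), hxw (r + 1) (by omega), w1, w2, x1]
        simp only [hu]; push_cast; ring
      · rw [row_n _ _ _ _ (by omega), hxw k (by omega), w1, x1, w3, x3]
        simp only [hu]; ring
      · rw [row_n1, w3]
        have hs : n + 1 = (k + 2) + (m + 1) := by omega
        rw [hs, Finset.sum_range_add]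
        have s1 : ∀ c ∈ Finset.range (k + 2), w c = -1 := by
          intro c hc
          have := Finset.mem_range.1 hc
          simp only [hw]; rw [if_pos (by omega)]
        have s2 : ∀ c ∈ Finset.range (m + 1), w (k + 2 + c) = q := by
          intro c hc
          have := Finset.mem_range.1 hc
          simp only [hw]; rw [if_neg (by omega), if_pos (by omega)]
        rw [Finset.sum_congr rfl s1, Finset.sum_congr rfl s2]
        simp only [Finset.sum_const, Finset.card_range, nsmul_eq_mul, hq]
        push_cast
        field_simp
        ring
      · rw [row_n2, w1, w3]; ring
      · rw [row_n3, w2]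

lemma exists_pos {σ : Type*} (p : MvPolynomial σ ℝ) (hp : p ≠ 0) (x : σ → ℝ)
    (hx : ∀ c, 0 < x c) (h0 : eval x p = 0) : ∃ u, 0 < p.coeff u := by
  by_contra! hc
  rw [eval_eq] at h0
  have hpos : ∀ d : σ →₀ ℕ, 0 < ∏ i ∈ d.support, x i ^ d i := fun d =>
    Finset.prod_pos fun i _ => pow_pos (hx i) _
  obtain ⟨d, hd⟩ := ne_zero_iff.1 hp
  have := (Finset.sum_eq_zero_iff_of_nonpos (fun d _ =>
    mul_nonpos_of_nonpos_of_nonneg (hc d) (hpos d).le)).1 h0 d (mem_support_iff.2 hd)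
  exact (mul_ne_zero hd (hpos d).ne') this

end PhosAux

/-- **`det A(n,i)` has coefficients of both signs** for `n ≥ 2` and `1 ≤ i ≤ n − 1`:
the singleton `{X_{i−1}+E}` is a circuit of multistationarity of the core `n`-site
phosphorylation network. -/
theorem stmt_12 (n i : ℕ) (hn : 2 ≤ n) (hi1 : 1 ≤ i) (hi2 : i ≤ n - 1) :
    (∃ u, 0 < ((phosMatrix n i).det).coeff u) ∧
    (∃ u, ((phosMatrix n i).det).coeff u < 0) := by
  obtain ⟨k, rfl⟩ : ∃ k, i = k + 1 := ⟨i - 1, by omega⟩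
  obtain ⟨x, hx, h0⟩ := PhosAux.det_zero n k (by omega)
  have hne := PhosAux.det_ne n k (by omega)
  refine ⟨PhosAux.exists_pos _ hne _ (fun c => hx c) h0, ?_⟩
  obtain ⟨u, hu⟩ := PhosAux.exists_pos (-(phosMatrix n (k + 1)).det) (neg_ne_zero.2 hne) _
    (fun c => hx c) (by rw [map_neg, h0, neg_zero])
  exact ⟨u, by simpa using hu⟩
end

section
/- Let n ≥ 2 and let λ_1,…,λ_{n+7} be strictly positive real numbers. Define the (n+7)×(n+7) real matrix G as follows: for 1 ≤ j ≤ n, row j has entries −λ_j in column j, λ_{j+1} in column j+1, −λ_{n+2} in column n+2, λ_{n+3} in column n+3, and 0 elsewhere; row n+1 has entries −λ_n in column n, −λ_{n+2} in column n+2, λ_{n+4} in column n+4; row n+2 has entries −λ_{n+1} in column n+1, −λ_{n+2} in column n+2, λ_{n+5} in column n+5; row n+3 has entries −λ_2 in column 2, −λ_{n+3} in column n+3, λ_{n+6} in column n+6; row n+4 has entries −λ_1 in column 1, −λ_{n+3} in column n+3, λ_{n+7} in column n+7; row n+5 has entry 1 in columns 1,…,n+1 and in columns n+4, n+5, n+6,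 n+7; row n+6 has entry 1 in columns n+2, n+4, n+5; row n+7 has entry 1 in columns n+3, n+6, n+7; all other entries are 0. Then (−1)^n · det(G) > 0. -/
def gEnt (n : ℕ) (L : ℕ → ℝ) (r c : ℕ) : ℝ :=
      if r < n then
        (if c = r then -L c
         else if c = r + 1 then L c
         else if c = n + 1 then -L c
         else if c = n + 2 then L c
         else 0)
      else if r = n then
        (if c + 1 = n then -L c
         else if c = n + 1 then -L c
         else if c = n + 3 then L c
         else 0)
      else if r = n + 1 then
        (if c = n then -L c
         else if c = n + 1 then -L c
         else if c = n + 4 then L c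
         else 0)
      else if r = n + 2 then
        (if c = 1 then -L c
         else if c = n + 2 then -L c
         else if c = n + 5 then L c
         else 0)
      else if r = n + 3 then
        (if c = 0 then -L c
         else if c = n + 2 then -L c
         else if c = n + 6 then L c
         else 0)
      else if r = n + 4 then
        (if c ≤ n ∨ (n + 3 ≤ c ∧ c ≤ n + 6) then 1 else 0)
      else if r = n + 5 then
        (if c = n + 1 ∨ c = n + 3 ∨ c = n + 4 then 1 else 0)
      else
        (if c = n + 2 ∨ c = n + 5 ∨ c = n + 6 then 1 else 0)

def cMain (n j : ℕ) : ℕ := if j < n then j + 1 else j + 3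

def cTail (n k : ℕ) : ℕ := if k = 0 then 0 else n + k

/-- solution coefficients -/
def yco (n j : ℕ) : Fin 3 → ℝ :=
  if j < n then ![1, j + 1, -(j + 1)]
  else if j = n then ![1, n, -(n - 1)]
  else if j = n + 1 then ![1, n + 1, -n]
  else if j = n + 2 then ![1, 1, 0]
  else ![1, 0, 1]

lemma gdiag (n : ℕ) (L : ℕ → ℝ) (i : ℕ) (hi : i < n + 4) :
    gEnt n L i (cMain n i) = L (cMain n i) := by
  grind [gEnt, cMain]

lemma gupper (n : ℕ) (L : ℕ → ℝ) (hn : 2 ≤ n) (i j : ℕ) (hi : i < j) (hj : j < n + 4) :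
    gEnt n L i (cMain n j) = 0 := by
  grind [gEnt, cMain]

/-- index of the off-diagonal entry -/
def gPred (n i : ℕ) : ℕ := if i < n then i - 1 else if i = n + 2 then 0 else i - 2

lemma goff (n : ℕ) (L : ℕ → ℝ) (hn : 2 ≤ n) (i j : ℕ) (hi : i < n + 4) (hj : j < n + 4)
    (h : j ≠ i) (h' : j ≠ gPred n i) : gEnt n L i (cMain n j) = 0 := by
  grind [gEnt, cMain, gPred]

lemma goff0 (n : ℕ) (L : ℕ → ℝ) (hn : 2 ≤ n) (i j : ℕ) (hi : i = 0 ∨ i = n + 3) (hj : j < n + 4)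
    (h : j ≠ i) : gEnt n L i (cMain n j) = 0 := by
  grind [gEnt, cMain]

lemma gpred (n : ℕ) (L : ℕ → ℝ) (hn : 2 ≤ n) (i : ℕ) (hi : 0 < i) (hi : i < n + 3) :
    gEnt n L i (cMain n (gPred n i)) = - L (cMain n (gPred n i)) := by
  grind [gEnt, cMain, gPred]

lemma gB (n : ℕ) (L : ℕ → ℝ) (hn : 2 ≤ n) (i : ℕ) (hi : 0 < i) (hi : i < n + 3) (k : Fin 3) :
    gEnt n L i (cTail n k) = (yco n (gPred n i) k - yco n i k) * L (cTail n k) := by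
  have h1 : ((n - 2 : ℕ) : ℝ) = n - 2 := by
    rw [Nat.cast_sub (by omega)]; simp
  have h2 : ((n - 1 : ℕ) : ℝ) = n - 1 := by
    rw [Nat.cast_sub (by omega)]; simp
  have h3 : ((i - 1 : ℕ) : ℝ) = i - 1 := by
    rw [Nat.cast_sub (by omega)]; simp
  have hc : i < n ∨ i = n ∨ i = n + 1 ∨ i = n + 2 := by omega
  rcases hc with h | rfl | rfl | rfl
  · have h' : i - 1 < n := by omega
    have e : ∀ k, yco n (gPred n i) k - yco n i k = ![0, -1, 1] k := by
      intro k
      fin_cases k <;> simp [yco, gPred, h, h', h3]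
    rw [e]
    fin_cases k <;> simp [gEnt, cTail, h] <;> grind
  · have h' : i - 2 < i := by omega
    have e : ∀ k, yco i (gPred i i) k - yco i i k = ![0, -1, 0] k := by
      intro k
      fin_cases k <;> simp [yco, gPred, h', h1] <;> ring
    rw [e]
    fin_cases k <;> simp [gEnt, cTail] <;> grind
  · have h' : n - 1 < n := by omega
    have e : ∀ k, yco n (gPred n (n+1)) k - yco n (n+1) k = ![0, -1, 0] k := by
      intro k
      fin_cases k <;> simp [yco, gPred, h', h2]
    rw [e]
    fin_cases k <;> simp [gEnt, cTail] <;> grind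
  · have h' : 0 < n := by omega
    have e : ∀ k, yco n (gPred n (n+2)) k - yco n (n+2) k = ![0, 0, -1] k := by
      intro k
      fin_cases k <;> simp [yco, gPred, h']
    rw [e]
    fin_cases k <;> simp [gEnt, cTail] <;> grind

lemma gB0 (n : ℕ) (L : ℕ → ℝ) (hn : 2 ≤ n) (i : ℕ) (hi : i = 0 ∨ i = n + 3) (k : Fin 3) :
    gEnt n L i (cTail n k) = (- yco n i k) * L (cTail n k) := by
  have h' : 0 < n := by omega
  rcases hi with rfl | rfl
  · fin_cases k <;> simp [gEnt, cTail, yco, h'] <;> grind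
  · fin_cases k <;> simp [gEnt, cTail, yco]

lemma gC (n : ℕ) (L : ℕ → ℝ) (j : ℕ) (hj : j < n + 4) :
    gEnt n L (n + 4) (cMain n j) = 1 ∧
    gEnt n L (n + 5) (cMain n j) = (if j = n ∨ j = n + 1 then 1 else 0) ∧
    gEnt n L (n + 6) (cMain n j) = (if j = n + 2 ∨ j = n + 3 then 1 else 0) := by
  refine ⟨?_, ?_, ?_⟩ <;> grind [gEnt, cMain]

lemma gD (n : ℕ) (L : ℕ → ℝ) (hn : 2 ≤ n) (i k : Fin 3) :
    gEnt n L (n + 4 + i) (cTail n k) = if i = k then 1 else 0 := by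
  fin_cases i <;> fin_cases k <;> simp [gEnt, cTail] <;> grind

lemma final_ineq (x A B a b c d e f : ℝ) (hx : 2 ≤ x) (hA : 0 < A) (hB : 0 ≤ B) (hBA : B ≤ x * A)
    (ha : 0 < a) (hb : 0 < b) (hc : 0 < c) (hd : 0 < d) (he : 0 < e) (hf : 0 < f) :
    0 < (!![A+a+b+c+d, B+x*a+(x+1)*b+c, -B-(x-1)*a-x*b+d;
      a+b, e+x*a+(x+1)*b, -(x-1)*a-x*b;
      c+d, c, f+d] : Matrix (Fin 3) (Fin 3) ℝ).det := by
  obtain ⟨m, rfl⟩ : ∃ m, x = m + 2 := ⟨x - 2, by ring⟩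
  have hm : 0 ≤ m := by linarith
  obtain ⟨Z, hZ⟩ : ∃ Z, (m+2) * A = B + Z := ⟨(m+2)*A - B, by ring⟩
  have hZ0 : 0 ≤ Z := by linarith
  have key : (!![A+a+b+c+d, B+(m+2)*a+((m+2)+1)*b+c, -B-((m+2)-1)*a-(m+2)*b+d;
      a+b, e+(m+2)*a+((m+2)+1)*b, -((m+2)-1)*a-(m+2)*b;
      c+d, c, f+d] : Matrix (Fin 3) (Fin 3) ℝ).det
      = A * ((e + (m+2)*a + (m+3)*b) * d + e * f + b * f + ((m+1)*a+(m+2)*b)*c)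
        + Z * (a+b) * f + B * (e * (c+d))
        + e * ((a+b)*(f+d) + ((m+1)*a+(m+2)*b)*(c+d))
        + f * ((e + (m+1)*a+(m+2)*b)*c + (e+(m+2)*a+(m+3)*b)*d) := by
    rw [Matrix.det_fin_three]
    simp
    linear_combination (a+b)*f*hZ
  rw [key]
  positivity

lemma rho_exists (n : ℕ) : ∃ ρ : Equiv.Perm (Fin (n + 7)),
    ((Equiv.Perm.sign ρ : ℤ) : ℝ) = (-1) ^ n ∧
    (∀ j : Fin (n + 4), (ρ (Fin.castAdd 3 j)).val = cMain n j) ∧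
    (∀ k : Fin 3, (ρ (Fin.natAdd (n + 4) k)).val = cTail n k) := by
  let τ : Equiv.Perm (Fin (n + 7)) :=
    finSumFinEquiv.permCongr (Equiv.sumCongr (1 : Equiv.Perm (Fin n)) (finRotate 7))
  have h1 : ∀ i : Fin (n + 7), i.val < n → τ i = i := by
    intro i hi
    have : i = Fin.castAdd 7 ⟨i.val, hi⟩ := rfl
    have h' : finSumFinEquiv.symm i = Sum.inl (⟨i.val, hi⟩ : Fin n) := by
      rw [Equiv.symm_apply_eq]; exact this
    simp [τ, Equiv.permCongr_apply, h']
  have h2 : ∀ i : Fin 7, τ (Fin.natAdd n i) = Fin.natAdd n (finRotate 7 i) := by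
    intro i
    simp [τ, Equiv.permCongr_apply]
  have h3 : ∀ i : Fin 7, τ (τ (Fin.natAdd n i)) = Fin.natAdd n (i + 2) := by
    intro i
    rw [h2, h2]
    congr 1
    revert i
    decide
  have h4 : ∀ i : Fin (n + 7), i.val < n + 6 → (finRotate (n + 7) i).val = i.val + 1 := by
    intro i hi
    have := @finRotate_of_lt (n + 6) i.val hi
    exact congrArg Fin.val this
  have h5 : ∀ i : Fin (n + 7), i.val = n + 6 → (finRotate (n + 7) i).val = 0 := by
    intro i hi
    have := @finRotate_last' (n + 6)
    have h : i = ⟨n + 6, by omega⟩ := Fin.ext hi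
    rw [h]
    exact congrArg Fin.val this
  refine ⟨finRotate (n + 7) * (τ * τ), ?_, ?_, ?_⟩
  · rw [Equiv.Perm.sign_mul, Equiv.Perm.sign_mul, Int.units_mul_self, mul_one, sign_finRotate]
    simp [pow_add]
  · intro j
    rw [Equiv.Perm.mul_apply, Equiv.Perm.mul_apply]
    by_cases hj : j.val < n
    · rw [h1 (Fin.castAdd 3 j) hj, h1 (Fin.castAdd 3 j) hj, h4 _ (by simp; omega)]
      simp [cMain, hj]
    · have hj2 := j.isLt
      obtain ⟨i, hi⟩ : ∃ i : Fin 4, j.val = n + i.val := ⟨⟨j.val - n, by omega⟩, by simp; omega⟩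
      have : (Fin.castAdd 3 j : Fin (n + 7)) = Fin.natAdd n (⟨i.val, by omega⟩ : Fin 7) := by
        apply Fin.ext; simp [hi]
      rw [this, h3]
      have : ((⟨i.val, by omega⟩ : Fin 7) + 2).val = i.val + 2 := by
        have hd : ∀ i : Fin 4, ((⟨i.val, by omega⟩ : Fin 7) + 2).val = i.val + 2 := by
          clear * -
          intro i
          fin_cases i <;> rfl
        exact hd i
      rw [h4 _ (by simp [this]; omega)]
      simp [this, cMain, hi]
      omega
  · intro k
    rw [Equiv.Perm.mul_apply, Equiv.Perm.mul_apply]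
    have hk : (Fin.natAdd (n + 4) k : Fin (n + 7)) = Fin.natAdd n (⟨4 + k.val, by omega⟩ : Fin 7) := by
      apply Fin.ext; simp; omega
    rw [hk, h3]
    fin_cases k
    · rw [h5 _ (by rfl)]; rfl
    · rw [h4 _ (by show n + 0 < n + 6; omega)]; rfl
    · rw [h4 _ (by show n + 1 < n + 6; omega)]; rfl

set_option maxHeartbeats 4000000 in
lemma det_pos_core (n : ℕ) (hn : 2 ≤ n) (L : ℕ → ℝ) (hL : ∀ j, 0 < L j) :
    0 < (-1 : ℝ) ^ n * (Matrix.of (fun r c : Fin (n + 7) => gEnt n L r.val c.val)).det := by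
  obtain ⟨ρ, hs, hm, ht⟩ := rho_exists n
  rw [← hs, ← Matrix.det_permute']
  set A : Matrix (Fin (n + 4)) (Fin (n + 4)) ℝ := Matrix.of fun i j => gEnt n L i (cMain n j) with hA
  set B : Matrix (Fin (n + 4)) (Fin 3) ℝ := Matrix.of fun i k => gEnt n L i (cTail n k) with hB
  set C : Matrix (Fin 3) (Fin (n + 4)) ℝ :=
    Matrix.of fun i j => gEnt n L (n + 4 + i) (cMain n j) with hC
  set D : Matrix (Fin 3) (Fin 3) ℝ :=
    Matrix.of fun i k => gEnt n L (n + 4 + i) (cTail n k) with hD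
  set X : Matrix (Fin (n + 4)) (Fin 3) ℝ :=
    Matrix.of fun j k => yco n j k / L (cMain n j) with hX
  set P : Matrix (Fin 3) (Fin 3) ℝ := Matrix.diagonal fun k => 1 / L (cTail n k) with hP
  have hLne : ∀ j, L j ≠ 0 := fun j => (hL j).ne'
  have e1 : ((Matrix.of (fun r c : Fin (n + 7) => gEnt n L r.val c.val)).submatrix id ρ).det
      = (Matrix.fromBlocks A B C D).det := by
    rw [← Matrix.det_submatrix_equiv_self (finSumFinEquiv (m := n + 4) (n := 3))]
    congr 1
    ext i j
    rcases i with i | i <;> rcases j with j | j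
    · simp [A, hm]
    · simp [B, ht]
    · simp [C, hm]
    · simp [D, ht]
  rw [e1]
  have hAX : A * X + B * P = 0 := by
    ext i k
    rw [Matrix.add_apply, hP, Matrix.mul_diagonal, Matrix.mul_apply]
    have hi := i.isLt
    have hBv : ∀ s : ℝ, gEnt n L i (cTail n k) = s * L (cTail n k) →
        B i k * (1 / L (cTail n k)) = s := by
      intro s h
      simp only [B, Matrix.of_apply, h]
      rw [mul_assoc, mul_one_div_cancel (hLne _), mul_one]
    have hcases : (i.val = 0 ∨ i.val = n + 3) ∨ (0 < i.val ∧ i.val < n + 3) := by omega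
    rcases hcases with h | ⟨h, h'⟩
    · rw [hBv _ (gB0 n L hn i h k), Finset.sum_eq_single i]
      · simp only [A, X, Matrix.of_apply, gdiag n L i hi]
        rw [mul_div_cancel₀ _ (hLne _)]
        simp
      · intro j _ hj
        simp only [A, Matrix.of_apply]
        rw [goff0 n L hn i j h j.isLt (fun h => hj (Fin.ext h)), zero_mul]
      · simp
    · have hp : gPred n i < i.val := by unfold gPred; split_ifs <;> omega
      rw [hBv _ (gB n L hn i h h' k),
        Finset.sum_eq_add i (⟨gPred n i, by omega⟩ : Fin (n + 4))]
      · simp only [A, X, Matrix.of_apply, gdiag n L i hi, gpred n L hn i h h']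
        rw [mul_div_cancel₀ _ (hLne _), neg_mul, mul_div_cancel₀ _ (hLne _), Matrix.zero_apply]
        ring
      · intro hh
        have := congrArg Fin.val hh
        simp only at this
        omega
      · intro j _ hj
        simp only [A, Matrix.of_apply]
        rw [goff n L hn i j hi j.isLt (fun h => hj.1 (Fin.ext h)) (fun h => hj.2 (Fin.ext h)),
          zero_mul]
      · simp
      · simp
  have hmul : Matrix.fromBlocks A B C D * Matrix.fromBlocks 1 X 0 P
      = Matrix.fromBlocks A 0 C (C * X + D * P) := by
    rw [Matrix.fromBlocks_multiply, hAX]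
    simp
  have hdet := congrArg Matrix.det hmul
  rw [Matrix.det_mul, Matrix.det_fromBlocks_zero₁₂, Matrix.det_fromBlocks_zero₂₁, Matrix.det_one,
    one_mul] at hdet
  have hPpos : 0 < P.det := by
    rw [hP, Matrix.det_diagonal]
    exact Finset.prod_pos fun k _ => one_div_pos.mpr (hL _)
  have hApos : 0 < A.det := by
    rw [Matrix.det_of_isLowerTriangular]
    · refine Finset.prod_pos fun i _ => ?_
      simp only [A, Matrix.of_apply, gdiag n L i i.isLt]
      exact hL _
    · intro i j hij
      simp only [A, Matrix.of_apply]
      exact gupper n L hn i j hij j.isLt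
  have hNpos : 0 < (C * X + D * P).det := by
    set SA : ℝ := 1 / L 0 + ∑ j : Fin n, 1 / L (j + 1) with hSA
    set SB : ℝ := ∑ j : Fin n, ((j : ℝ) + 1) / L (j + 1) with hSB
    have hN : C * X + D * P = !![SA+1/L (n+3)+1/L (n+4)+1/L (n+5)+1/L (n+6),
        SB+n*(1/L (n+3))+(n+1)*(1/L (n+4))+1/L (n+5),
        -SB-(n-1)*(1/L (n+3))-n*(1/L (n+4))+1/L (n+6);
      1/L (n+3)+1/L (n+4), 1/L (n+1)+n*(1/L (n+3))+(n+1)*(1/L (n+4)), -(n-1)*(1/L (n+3))-n*(1/L (n+4));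
      1/L (n+5)+1/L (n+6), 1/L (n+5), 1/L (n+2)+1/L (n+6)] := by
      ext i k
      rw [Matrix.add_apply, hP, Matrix.mul_diagonal, Matrix.mul_apply, Fin.sum_univ_add,
        Fin.sum_univ_four]
      have hc0 : ∀ j : Fin (n + 4), ∀ i : Fin 3, C i j = ![1, if j.val = n ∨ j.val = n + 1 then 1 else 0,
          if j.val = n + 2 ∨ j.val = n + 3 then 1 else 0] i := by
        intro j i
        obtain ⟨q1, q2, q3⟩ := gC n L j j.isLt
        fin_cases i
        · exact q1
        · exact q2
        · exact q3
      have hx0 : ∀ j : Fin n, X (Fin.castAdd 4 j) k = ![1, (j:ℝ) + 1, -((j:ℝ) + 1)] k / L (j + 1) := by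
        intro j
        simp [X, cMain, yco]
      have hlt : ∀ j : Fin n, (¬ (j.val = n ∨ j.val = n + 1)) ∧ ¬ (j.val = n + 2 ∨ j.val = n + 3) := by
        intro j; have := j.isLt; omega
      have x0 : X (Fin.natAdd n 0) k = ![1, (n:ℝ), -(n - 1)] k / L (n + 3) := by
        simp [X, cMain, yco]
      have x1 : X (Fin.natAdd n 1) k = ![1, (n:ℝ) + 1, -n] k / L (n + 4) := by
        simp [X, cMain, yco]
      have x2 : X (Fin.natAdd n 2) k = ![1, 1, 0] k / L (n + 5) := by
        simp [X, cMain, yco]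
      have x3 : X (Fin.natAdd n 3) k = ![1, 0, 1] k / L (n + 6) := by
        simp [X, cMain, yco]
      have hd : D i k = if i = k then 1 else 0 := gD n L hn i k
      simp only [hx0, x0, x1, x2, x3, hc0, hd, Fin.val_castAdd, Fin.val_natAdd, (hlt _).1, (hlt _).2]
      clear hx0 x0 x1 x2 x3 hc0 hd hdet hmul hAX e1
      fin_cases i <;> fin_cases k <;>
        simp [cTail, SA, SB, neg_div, Finset.sum_neg_distrib, -neg_add_rev] <;> ring
    rw [hN]
    have hn' : (2 : ℝ) ≤ n := by exact_mod_cast hn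
    have hpos : ∀ j, 0 < 1 / L j := fun j => one_div_pos.mpr (hL j)
    apply final_ineq
    · exact hn'
    · exact add_pos_of_pos_of_nonneg (hpos 0) (Finset.sum_nonneg fun j _ => (hpos _).le)
    · exact Finset.sum_nonneg fun j _ => div_nonneg (by positivity) (hL _).le
    · rw [hSA, hSB, mul_add, Finset.mul_sum]
      have : ∑ j : Fin n, ((j : ℝ) + 1) / L (j + 1) ≤ ∑ j : Fin n, (n : ℝ) * (1 / L (j + 1)) := by
        refine Finset.sum_le_sum fun j _ => ?_
        rw [mul_one_div]
        apply div_le_div_of_nonneg_right _ (hL _).le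
        exact_mod_cast j.isLt
      have := mul_pos (by linarith : (0:ℝ) < n) (hpos 0)
      linarith
    all_goals exact hpos _
  have : 0 < (Matrix.fromBlocks A B C D).det * P.det := by
    rw [hdet]; exact mul_pos hApos hNpos
  exact (mul_pos_iff_of_pos_right hPpos).mp this

/-- **`(−1)^n·det(Γ̃_C) > 0` on the positive orthant** for
`C = {X_{n−1}+E, X_n+E, X_1+F, X_0+F}` in the core `n`-site phosphorylation network.
Indexing is 0-based: the entry `λ_j` (1-based) of the statement is `l ⟨j-1⟩`. -/
theorem stmt_13 (n : ℕ) (hn : 2 ≤ n) (l : Fin (n + 7) → ℝ) (hl : ∀ j, 0 < l j) :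
    0 < (-1 : ℝ) ^ n * (Matrix.of (fun r c : Fin (n + 7) =>
      if r.val < n then
        (if c.val = r.val then -l c
         else if c.val = r.val + 1 then l c
         else if c.val = n + 1 then -l c
         else if c.val = n + 2 then l c
         else 0)
      else if r.val = n then
        (if c.val + 1 = n then -l c
         else if c.val = n + 1 then -l c
         else if c.val = n + 3 then l c
         else 0)
      else if r.val = n + 1 then
        (if c.val = n then -l c
         else if c.val = n + 1 then -l c
         else if c.val = n + 4 then l c
         else 0)
      else if r.val = n + 2 then
        (if c.val = 1 then -l c
         else if c.val = n + 2 then -l c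
         else if c.val = n + 5 then l c
         else 0)
      else if r.val = n + 3 then
        (if c.val = 0 then -l c
         else if c.val = n + 2 then -l c
         else if c.val = n + 6 then l c
         else 0)
      else if r.val = n + 4 then
        (if c.val ≤ n ∨ (n + 3 ≤ c.val ∧ c.val ≤ n + 6) then 1 else 0)
      else if r.val = n + 5 then
        (if c.val = n + 1 ∨ c.val = n + 3 ∨ c.val = n + 4 then 1 else 0)
      else
        (if c.val = n + 2 ∨ c.val = n + 5 ∨ c.val = n + 6 then 1 else 0))).det := by
  have h := det_pos_core n hn (fun k => if h : k < n + 7 then l ⟨k, h⟩ else 1) (by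
    intro j
    by_cases h : j < n + 7
    · simp [h, hl]
    · simp [h])
  simpa [gEnt] using h
end

section
/- Work in the polynomial ring ℝ[X_1,…,X_8] and let H be the 8×8 matrix over this ring with rows: (−X_1, X_2, −X_3, X_4, 0, 0, 0, 0); (−X_1, 0, −X_3, 0, X_5, 0, 0, 0); (0, −X_2, −X_3, 0, 0, X_6, 0, 0); (0, −X_2, 0, −X_4, 0, 0, X_7, 0); (−X_1, 0, 0, −X_4, 0, 0, 0, X_8); (1, 1, 0, 0, 1, 1, 1, 1); (0, 0, 1, 0, 1, 1, 0, 0); (0, 0, 0, 1, 0, 0, 1, 1). Then det(H) is a nonzero polynomial all of whose nonzero coefficients have the same sign; in particular det(H) does not have both a positive and a negative coefficient. -/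
open MvPolynomial

/-- The matrix `Γ̃_𝒞` of the determinant criterion for the largest canonical extension of
the core 1-site phosphorylation network (variables 0-based: `X_j` (1-based) is `X ⟨j-1⟩`). -/
noncomputable def oneSiteMatrix : Matrix (Fin 8) (Fin 8) (MvPolynomial (Fin 8) ℝ) :=
  !![-X 0,  X 1, -X 2,  X 3,    0,   0,   0,   0;
     -X 0,    0, -X 2,    0,  X 4,   0,   0,   0;
         0, -X 1, -X 2,   0,    0, X 5,   0,   0;
         0, -X 1,    0, -X 3,   0,   0, X 6,   0;
     -X 0,    0,    0, -X 3,   0,   0,   0, X 7;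
         1,    1,    0,    0,   1,   1,   1,   1;
         0,    0,    1,    0,   1,   1,   0,   0;
         0,    0,    0,    1,   0,   0,   1,   1]

set_option maxHeartbeats 4000000 in
theorem det_aux {R : Type*} [CommRing R] (a b c d e f g h : R) :
    (!![-a, b, -c, d, 0, 0, 0, 0;
       -a, 0, -c, 0, e, 0, 0, 0;
       0, -b, -c, 0, 0, f, 0, 0;
       0, -b, 0, -d, 0, 0, g, 0;
       -a, 0, 0, -d, 0, 0, 0, h;
       1, 1, 0, 0, 1, 1, 1, 1;
       0, 0, 1, 0, 1, 1, 0, 0;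
       0, 0, 0, 1, 0, 0, 1, 1] : Matrix (Fin 8) (Fin 8) R).det =
    -(2 * a * b * c * e * g + a * b * c * e * h + a * b * c * f * g + 2 * a * b * d * e * g + a * b * d * e * h + a * b * d * f * g + a * b * e * f * g + a * b * e * f * h + a * b * e * g * h + a * b * f * g * h + 2 * a * c * d * e * g + a * c * d * e * h + a * c * d * f * g + a * c * e * g * h + 2 * a * d * e * f * g + a * d * e * f * h + a * e * f * g * h + 2 * b * c * d * e * g + b * c * d * e * h + b * c * d * f * g + 2 * b * c * e * g * h + b * c * f * g * h + b * d * e * f * g + b * e * f * g * h) := by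
  simp [Matrix.det_succ_row_zero, Fin.sum_univ_succ, Fin.succAbove]
  ring

def NN (p : MvPolynomial (Fin 8) ℝ) : Prop := ∀ u, 0 ≤ p.coeff u

theorem NN.add {p q : MvPolynomial (Fin 8) ℝ} (hp : NN p) (hq : NN q) : NN (p + q) := by
  intro u
  rw [coeff_add]
  exact add_nonneg (hp u) (hq u)

theorem NN.mul {p q : MvPolynomial (Fin 8) ℝ} (hp : NN p) (hq : NN q) : NN (p * q) := by
  intro u
  rw [coeff_mul]
  exact Finset.sum_nonneg fun x _ => mul_nonneg (hp _) (hq _)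

theorem NN.X (i : Fin 8) : NN (MvPolynomial.X i) := by
  intro u
  classical
  rw [coeff_X]
  split_ifs <;> norm_num

theorem NN.two : NN 2 := by
  intro u
  classical
  have : (2 : MvPolynomial (Fin 8) ℝ) = C 2 := (map_ofNat C 2).symm
  rw [this, coeff_C]
  split_ifs <;> norm_num

/-- **`det(Γ̃_𝒞)` of the 1-site phosphorylation network is nonzero with all nonzero
coefficients of the same sign** (in particular it does not have both a positive and a
negative coefficient): the largest canonical extension is not multistationary. -/
theorem stmt_14 :
    oneSiteMatrix.det ≠ 0 ∧
      ((∀ u, 0 ≤ oneSiteMatrix.det.coeff u) ∨ (∀ u, oneSiteMatrix.det.coeff u ≤ 0)) := by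
  have key := det_aux (R := MvPolynomial (Fin 8) ℝ) (X 0) (X 1) (X 2) (X 3) (X 4) (X 5) (X 6) (X 7)
  have hM : oneSiteMatrix.det = _ := key
  rw [hM]
  refine ⟨?_, Or.inr ?_⟩
  · intro h0
    have := congrArg (eval (fun _ => (1 : ℝ))) h0
    simp at this
    norm_num at this
  · intro u
    rw [coeff_neg, neg_nonpos]
    revert u
    change NN _
    repeat' first | exact NN.X _ | exact NN.two | apply NN.add | apply NN.mul
end
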